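/- Let E and F be Archimedean Riesz spaces and let e ∈ E be a weak order unit of E. Let T : E → F be a bijective lattice homomorphism (T(x ⊔ y) = T(x) ⊔ T(y) and T(x ⊓ y) = T(x) ⊓ T(y) for all x, y ∈ E, and T is a bijection) such that T(λ·e) = λ·T(e) for every λ ∈ ℝ. Then T is linear, i.e. T(x + y) = T(x) + T(y) and T(c·x) = c·T(x) for all x, y ∈ E and c ∈ ℝ; hence T is a Riesz isomorphism. -/

import Mathlib

section RieszAux

theorem inf_eq_zero_of_le {E : Type*} [Zero E] [Lattice E] {a b a' b' : E}
    (h : a ⊓ b = 0) (ha : 0 ≤ a') (hb : 0 ≤ b') (haa : a' ≤ a) (hbb : b' ≤ b) : a' ⊓ b' = 0 :=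
  le_antisymm (h ▸ inf_le_inf haa hbb) (le_inf ha hb)

section Group

variable {E : Type*} [AddCommGroup E] [Lattice E] [IsOrderedAddMonoid E]

theorem posPart_sub_eq_sub_inf (p q : E) : (q - p)⁺ = q - p ⊓ q := by
  rw [sub_inf, sub_self, posPart_def]

theorem posPart_inf_posPart_neg (a : E) : a⁺ ⊓ (-a)⁺ = 0 := by
  rw [posPart_neg]
  exact posPart_inf_negPart_eq_zero a

theorem posPart_sub_inf_posPart_sub (a b : E) : (a - b)⁺ ⊓ (b - a)⁺ = 0 := by
  rw [← neg_sub a b]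
  exact posPart_inf_posPart_neg _

theorem posPart_add_le (a b : E) : (a + b)⁺ ≤ a⁺ + b⁺ :=
  sup_le (add_le_add (le_posPart a) (le_posPart b))
    (add_nonneg (posPart_nonneg a) (posPart_nonneg b))

theorem posPart_le_add_of_le_add {a b c : E} (h : a ≤ b + c) : a⁺ ≤ b⁺ + c⁺ :=
  (posPart_mono h).trans (posPart_add_le b c)

theorem inf_add_le_inf_add_inf {m a b : E} (hm : 0 ≤ m) (ha : 0 ≤ a) (hb : 0 ≤ b) :
    m ⊓ (a + b) ≤ m ⊓ a + m ⊓ b := by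
  rw [add_inf, inf_add, inf_add]
  refine le_inf (le_inf ?_ ?_) (le_inf ?_ inf_le_right)
  · exact inf_le_left.trans (le_add_of_nonneg_left hm)
  · exact inf_le_left.trans (le_add_of_nonneg_left ha)
  · exact inf_le_left.trans (le_add_of_nonneg_right hb)

theorem le_of_le_add_of_inf_eq_zero {m a b : E} (hm : 0 ≤ m) (ha : 0 ≤ a) (hb : 0 ≤ b)
    (h : m ≤ a + b) (hma : m ⊓ a = 0) : m ≤ b :=
  calc m = m ⊓ (a + b) := (inf_eq_left.2 h).symm
    _ ≤ m ⊓ a + m ⊓ b := inf_add_le_inf_add_inf hm ha hb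
    _ ≤ b := by rw [hma, zero_add]; exact inf_le_right

theorem inf_nsmul_eq_zero {m a : E} (hm : 0 ≤ m) (ha : 0 ≤ a) (h : m ⊓ a = 0) (n : ℕ) :
    m ⊓ n • a = 0 := by
  induction n with
  | zero => simpa using hm
  | succ k ih =>
    refine le_antisymm ?_ (le_inf hm (nsmul_nonneg ha _))
    rw [succ_nsmul]
    refine (inf_add_le_inf_add_inf hm (nsmul_nonneg ha k) ha).trans ?_
    rw [ih, h, add_zero]

theorem inf_posPart_eq_zero_of_inf_le {p a : E} (hp : 0 ≤ p) (h : p ⊓ a ≤ 0) :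
    p ⊓ a⁺ = 0 := by
  let := AddCommGroup.toDistribLattice E
  refine le_antisymm ?_ (le_inf hp (posPart_nonneg a))
  rw [posPart_def, inf_sup_left]
  exact sup_le h inf_le_right

/-- If `y ≤ w` agree below all multiples of `v`, then `w - y` is disjoint from `v`. -/
theorem inf_sub_eq_zero_of_inf_nsmul_eq (hArch : ∀ x y : E, (∀ n : ℕ, n • x ≤ y) → x ≤ 0)
    {y w v : E} (hy : 0 ≤ y) (hyw : y ≤ w) (hv : 0 ≤ v)
    (h : ∀ n : ℕ, w ⊓ n • v = y ⊓ n • v) :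
    v ⊓ (w - y) = 0 := by
  have hp : 0 ≤ v ⊓ (w - y) := le_inf hv (sub_nonneg.2 hyw)
  refine le_antisymm (hArch _ y fun n => ?_) hp
  set p := v ⊓ (w - y)
  have h1 : (p + y) ⊓ n • p ≤ y := by
    have h2 : p + y ≤ w := le_sub_iff_add_le.1 inf_le_right
    have h3 : n • p ≤ n • v := nsmul_le_nsmul_right inf_le_left n
    exact (inf_le_inf h2 h3).trans ((h n).le.trans inf_le_left)
  have h4 : p ⊓ (n • p - y) ≤ 0 := by
    have : p ⊓ (n • p - y) + y = (p + y) ⊓ n • p := by rw [inf_add, sub_add_cancel]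
    rw [← add_le_add_iff_right y, this, zero_add]
    exact h1
  have h5 := inf_posPart_eq_zero_of_inf_le hp h4
  have h6 : (n • p - y)⁺ ⊓ n • p = 0 :=
    inf_nsmul_eq_zero (posPart_nonneg _) hp (inf_comm p _ ▸ h5) n
  have h7 : (n • p - y)⁺ ≤ n • p :=
    sup_le (sub_le_self _ hy) (nsmul_nonneg hp n)
  rw [inf_eq_left.2 h7] at h6
  exact sub_nonpos.1 (posPart_eq_zero.1 h6)

theorem inf_eq_inf_of_inf_sub_eq_zero {y w v : E} (hy : 0 ≤ y) (hyw : y ≤ w)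
    (h : v ⊓ (w - y) = 0) : w ⊓ v = y ⊓ v := by
  have hv : 0 ≤ v := h ▸ inf_le_left
  refine le_antisymm (le_inf ?_ inf_le_right) (inf_le_inf_right v hyw)
  have h1 : w ⊓ v ≤ (w - y) + y := by rw [sub_add_cancel]; exact inf_le_left
  refine le_of_le_add_of_inf_eq_zero (le_inf (hy.trans hyw) hv) (sub_nonneg.2 hyw) hy h1 ?_
  exact inf_eq_zero_of_le h (le_inf (hy.trans hyw) hv) (sub_nonneg.2 hyw) inf_le_right le_rfl

theorem exists_inf_posPart_nsmul_sub_ne_zero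
    (hArch : ∀ x y : E, (∀ n : ℕ, n • x ≤ y) → x ≤ 0)
    {f : E} (hf : 0 ≤ f) (hunit : ∀ y : E, 0 ≤ y → y ⊓ f = 0 → y = 0)
    {h : E} (hh : 0 ≤ h) (hne : h ≠ 0) (u : E) : ∃ n : ℕ, h ⊓ (n • f - u)⁺ ≠ 0 := by
  by_contra! H
  have hg : 0 ≤ h ⊓ f := le_inf hh hf
  refine hne (hunit h hh (le_antisymm (hArch _ u⁺ fun n => ?_) hg))
  have h1 : n • (h ⊓ f) ≤ (n • f - u)⁺ + u⁺ := by
    refine (nsmul_le_nsmul_right inf_le_right n).trans ?_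
    calc n • f = (n • f - u) + u := (sub_add_cancel _ _).symm
      _ ≤ _ := add_le_add (le_posPart _) (le_posPart _)
  refine le_of_le_add_of_inf_eq_zero (nsmul_nonneg hg n) (posPart_nonneg _) (posPart_nonneg _)
    h1 ?_
  rw [inf_comm]
  refine inf_nsmul_eq_zero (posPart_nonneg _) hg ?_ n
  rw [inf_comm]
  exact inf_eq_zero_of_le (H n) hg (posPart_nonneg _) inf_le_left le_rfl

end Group

section Transport

variable {E F : Type*} [AddCommGroup E] [Lattice E] [IsOrderedAddMonoid E]
  [AddCommGroup F] [Lattice F] [IsOrderedAddMonoid F]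

/-- A lattice isomorphism fixing `0` preserves disjointness of a positive element from a
difference of positive elements. -/
theorem map_inf_map_sub_eq_zero (hArch : ∀ x y : F, (∀ n : ℕ, n • x ≤ y) → x ≤ 0)
    (G : E ≃o F) (hG : G 0 = 0) {v y w : E} (hy : 0 ≤ y) (hyw : y ≤ w)
    (h : v ⊓ (w - y) = 0) : G v ⊓ (G w - G y) = 0 := by
  have hnn : ∀ u, 0 ≤ u → 0 ≤ G u := fun u hu => hG ▸ G.monotone hu
  have hv : 0 ≤ v := h ▸ inf_le_left
  have hd : 0 ≤ w - y := sub_nonneg.2 hyw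
  refine inf_sub_eq_zero_of_inf_nsmul_eq hArch (hnn y hy) (G.monotone hyw) (hnn v hv) fun n => ?_
  obtain ⟨v', hv'⟩ := G.surjective (n • G v)
  have hv'0 : 0 ≤ v' := by
    rw [← G.le_iff_le, hv', hG]
    exact nsmul_nonneg (hnn v hv) n
  rw [← hv', ← G.map_inf, ← G.map_inf]
  congr 1
  refine inf_eq_inf_of_inf_sub_eq_zero hy hyw ?_
  set u := v' ⊓ (w - y)
  have hu0 : 0 ≤ u := le_inf hv'0 hd
  have huv : u ⊓ v = 0 := by
    rw [inf_comm]
    exact inf_eq_zero_of_le h hv hu0 le_rfl inf_le_right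
  have h1 : G u ⊓ G v = 0 := by rw [← G.map_inf, huv, hG]
  have h2 : G u ⊓ G v' = 0 := by
    rw [hv']
    exact inf_nsmul_eq_zero (hnn u hu0) (hnn v hv) h1 n
  rw [← G.map_inf, ← hG] at h2
  have h3 := G.injective h2
  rwa [inf_eq_left.2 (inf_le_left : u ≤ v')] at h3

theorem map_sub_inf_map_sub_inf_map_sub_eq_zero_of_nonneg
    (hArch : ∀ x y : F, (∀ n : ℕ, n • x ≤ y) → x ≤ 0)
    (G : E ≃o F) (hG : G 0 = 0) {p₁ q₁ p₂ q₂ p₃ q₃ : E}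
    (h₁ : 0 ≤ p₁) (hq₁ : p₁ ≤ q₁) (h₂ : 0 ≤ p₂) (hq₂ : p₂ ≤ q₂) (h₃ : 0 ≤ p₃) (hq₃ : p₃ ≤ q₃)
    (h : (q₁ - p₁) ⊓ (q₂ - p₂) ⊓ (q₃ - p₃) = 0) :
    (G q₁ - G p₁) ⊓ (G q₂ - G p₂) ⊓ (G q₃ - G p₃) = 0 := by
  obtain ⟨t, ht⟩ := G.surjective ((G q₁ - G p₁) ⊓ (G q₂ - G p₂) ⊓ (G q₃ - G p₃))
  have ht0 : 0 ≤ t := by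
    rw [← G.le_iff_le, ht, hG]
    exact le_inf (le_inf (sub_nonneg.2 (G.monotone hq₁)) (sub_nonneg.2 (G.monotone hq₂)))
      (sub_nonneg.2 (G.monotone hq₃))
  have key : ∀ {p q : E}, 0 ≤ p → p ≤ q → G t ≤ G q - G p →
      ∀ u, u ⊓ (q - p) = 0 → u ≤ t → u = 0 := by
    intro p q hp hpq hle u hu hut
    have hu0 : 0 ≤ u := hu ▸ inf_le_left
    have h1 := map_inf_map_sub_eq_zero hArch G hG hp hpq hu
    have h2 : G u ⊓ G t = 0 :=
      inf_eq_zero_of_le h1 (hG ▸ G.monotone hu0) (hG ▸ G.monotone ht0) le_rfl hle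
    rw [← G.map_inf, ← hG] at h2
    have h3 := G.injective h2
    rwa [inf_eq_left.2 hut] at h3
  have hd₁ := sub_nonneg.2 hq₁
  have hd₂ := sub_nonneg.2 hq₂
  have hd₃ := sub_nonneg.2 hq₃
  have e₃ : t ⊓ (q₁ - p₁) ⊓ (q₂ - p₂) = 0 := by
    refine key h₃ hq₃ (ht ▸ inf_le_right) _ ?_ (inf_le_left.trans inf_le_left)
    exact inf_eq_zero_of_le h (le_inf (le_inf ht0 hd₁) hd₂) hd₃
      (inf_le_inf_right _ inf_le_right) le_rfl
  have e₂ : t ⊓ (q₁ - p₁) = 0 :=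
    key h₂ hq₂ (ht ▸ inf_le_left.trans inf_le_right) _ e₃ inf_le_left
  have e₁ : t = 0 := key h₁ hq₁ (ht ▸ inf_le_left.trans inf_le_left) _ e₂ le_rfl
  rw [← ht, e₁, hG]

theorem map_sub_inf_map_sub_inf_map_sub_eq_zero
    (hArch : ∀ x y : F, (∀ n : ℕ, n • x ≤ y) → x ≤ 0)
    (T : E ≃o F) {p₁ q₁ p₂ q₂ p₃ q₃ : E}
    (hq₁ : p₁ ≤ q₁) (hq₂ : p₂ ≤ q₂) (hq₃ : p₃ ≤ q₃)
    (h : (q₁ - p₁) ⊓ (q₂ - p₂) ⊓ (q₃ - p₃) = 0) :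
    (T q₁ - T p₁) ⊓ (T q₂ - T p₂) ⊓ (T q₃ - T p₃) = 0 := by
  set b := p₁ ⊓ p₂ ⊓ p₃
  let G : E ≃o F := (OrderIso.addRight b).trans (T.trans (OrderIso.addRight (-T b)))
  have hG : ∀ x, G x = T (x + b) + -T b := fun _ => rfl
  have := map_sub_inf_map_sub_inf_map_sub_eq_zero_of_nonneg hArch G (by simp [hG])
    (p₁ := p₁ - b) (q₁ := q₁ - b) (p₂ := p₂ - b) (q₂ := q₂ - b) (p₃ := p₃ - b) (q₃ := q₃ - b)
    (sub_nonneg.2 (inf_le_left.trans inf_le_left)) (sub_le_sub_right hq₁ b)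
    (sub_nonneg.2 (inf_le_left.trans inf_le_right)) (sub_le_sub_right hq₂ b)
    (sub_nonneg.2 inf_le_right) (sub_le_sub_right hq₃ b)
    (by simpa only [sub_sub_sub_cancel_right] using h)
  simpa only [hG, sub_add_cancel, add_sub_add_right_eq_sub] using this

end Transport

section WeakUnit

variable {F : Type*} [AddCommGroup F] [Lattice F] [IsOrderedAddMonoid F] [Module ℝ F]
  [PosSMulMono ℝ F]

theorem exists_pos_inf_posPart_sub_smul_ne_zero
    (hArch : ∀ x y : F, (∀ n : ℕ, n • x ≤ y) → x ≤ 0)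
    {f : F} (hf : 0 ≤ f) {h d : F} (hh : 0 ≤ h) (hne : h ≠ 0) (hd : h ≤ d⁺) :
    ∃ δ : ℝ, 0 < δ ∧ h ⊓ (d - δ • f)⁺ ≠ 0 := by
  by_contra! H
  refine hne (le_antisymm (hArch h f fun n => ?_) hh)
  have hn : (0 : ℝ) < n + 1 := by positivity
  have hδ : (0 : ℝ) < (n + 1 : ℝ)⁻¹ := inv_pos.2 hn
  have hδf : 0 ≤ (n + 1 : ℝ)⁻¹ • f := smul_nonneg hδ.le hf
  have h1 : d⁺ ≤ (d - (n + 1 : ℝ)⁻¹ • f)⁺ + (n + 1 : ℝ)⁻¹ • f := by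
    have := posPart_add_le (d - (n + 1 : ℝ)⁻¹ • f) ((n + 1 : ℝ)⁻¹ • f)
    rwa [sub_add_cancel, posPart_of_nonneg hδf] at this
  have h2 : h ≤ (n + 1 : ℝ)⁻¹ • f :=
    le_of_le_add_of_inf_eq_zero hh (posPart_nonneg _) hδf (hd.trans h1) (H _ hδ)
  have h3 : (n + 1 : ℝ) • h ≤ f := by
    have := smul_le_smul_of_nonneg_left h2 hn.le
    rwa [smul_inv_smul₀ hn.ne'] at this
  rw [add_smul, one_smul, Nat.cast_smul_eq_nsmul] at h3
  exact (le_add_of_nonneg_right hh).trans h3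

/-- Where `u < z`, some multiple of the weak order unit lies strictly in between. -/
theorem exists_inf_posPart_smul_sub_inf_posPart_sub_smul_ne_zero
    (hArch : ∀ x y : F, (∀ n : ℕ, n • x ≤ y) → x ≤ 0)
    {f : F} (hf : 0 ≤ f) (hunit : ∀ y : F, 0 ≤ y → y ⊓ f = 0 → y = 0)
    {h u z : F} (hh : 0 ≤ h) (hne : h ≠ 0) (hle : h ≤ (z - u)⁺) :
    ∃ a : ℝ, h ⊓ (a • f - u)⁺ ⊓ (z - a • f)⁺ ≠ 0 := by
  by_contra! H
  obtain ⟨δ, hδ, hne₁⟩ := exists_pos_inf_posPart_sub_smul_ne_zero hArch hf hh hne hle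
  have hh₁ : 0 ≤ h ⊓ (z - u - δ • f)⁺ := le_inf hh (posPart_nonneg _)
  obtain ⟨N, hne₂⟩ := exists_inf_posPart_nsmul_sub_ne_zero hArch hf hunit hh₁ hne₁ (-u)
  set k := h ⊓ (z - u - δ • f)⁺ ⊓ (N • f - -u)⁺
  have hk0 : 0 ≤ k := le_inf hh₁ (posPart_nonneg _)
  obtain ⟨K, hne₃⟩ := exists_inf_posPart_nsmul_sub_ne_zero hArch hf hunit hk0 hne₂ u
  have hP : ∀ n : ℕ, k ⊓ ((n * δ - N : ℝ) • f - u)⁺ = 0 := by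
    intro n
    induction n with
    | zero =>
      refine inf_eq_zero_of_le (posPart_inf_posPart_neg (N • f - -u)) hk0 (posPart_nonneg _)
        inf_le_right (le_of_eq ?_)
      congr 1
      rw [← Nat.cast_smul_eq_nsmul ℝ]
      push_cast
      module
    | succ n ih =>
      set a : ℝ := n * δ - N with ha
      have hb : ((n + 1 : ℕ) * δ - N : ℝ) = a + δ := by rw [ha]; push_cast; ring
      rw [hb]
      have hm : 0 ≤ k ⊓ ((a + δ) • f - u)⁺ := le_inf hk0 (posPart_nonneg _)
      have hsplit : (z - u - δ • f)⁺ ≤ (a • f - u)⁺ + (z - (a + δ) • f)⁺ :=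
        posPart_le_add_of_le_add (le_of_eq (by module))
      have hmle : k ⊓ ((a + δ) • f - u)⁺ ≤ (z - (a + δ) • f)⁺ := by
        refine le_of_le_add_of_inf_eq_zero hm (posPart_nonneg _) (posPart_nonneg _)
          ((inf_le_left.trans (inf_le_left.trans inf_le_right)).trans hsplit) ?_
        exact inf_eq_zero_of_le ih hm (posPart_nonneg _) inf_le_left le_rfl
      refine le_antisymm ?_ hm
      rw [← H (a + δ)]
      exact le_inf (inf_le_inf_right _ (inf_le_left.trans inf_le_left)) hmle
  obtain ⟨n, hn⟩ := exists_nat_ge ((K + N) / δ)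
  have hn' : (K : ℝ) ≤ n * δ - N := by
    rw [div_le_iff₀ hδ] at hn
    linarith
  refine hne₃ (inf_eq_zero_of_le (hP n) hk0 (posPart_nonneg _) le_rfl (posPart_mono ?_))
  refine sub_le_sub_right ?_ u
  rw [← Nat.cast_smul_eq_nsmul ℝ, ← sub_nonneg, ← sub_smul]
  exact smul_nonneg (sub_nonneg.2 hn') hf

end WeakUnit

section Linear

variable {E F : Type*} [AddCommGroup E] [Lattice E] [IsOrderedAddMonoid E] [Module ℝ E]
  [AddCommGroup F] [Lattice F] [IsOrderedAddMonoid F] [Module ℝ F] [PosSMulMono ℝ F]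

theorem map_add_le_of_map_smul_weak_unit
    (hArch : ∀ x y : F, (∀ n : ℕ, n • x ≤ y) → x ≤ 0) (T : E ≃o F)
    {e : E} {f : F} (hf : 0 ≤ f) (hunit : ∀ y : F, 0 ≤ y → y ⊓ f = 0 → y = 0)
    (hTe : ∀ c : ℝ, T (c • e) = c • f) (x y : E) : T (x + y) ≤ T x + T y := by
  by_contra hcon
  have hne : (T (x + y) - T y - T x)⁺ ≠ 0 := fun h0 => hcon <| by
    have := posPart_eq_zero.1 h0
    rwa [sub_sub, sub_nonpos, add_comm (T y)] at this
  obtain ⟨a, ha⟩ := exists_inf_posPart_smul_sub_inf_posPart_sub_smul_ne_zero hArch hf hunit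
    (posPart_nonneg _) hne le_rfl
  have hnn : 0 ≤ (T (x + y) - T y - T x)⁺ ⊓ (a • f - T x)⁺ ⊓ (T (x + y) - T y - a • f)⁺ :=
    le_inf (le_inf (posPart_nonneg _) (posPart_nonneg _)) (posPart_nonneg _)
  obtain ⟨b, hb⟩ := exists_inf_posPart_smul_sub_inf_posPart_sub_smul_ne_zero hArch hf hunit
    (u := T y) (z := T (x + y) - a • f) hnn ha
    (inf_le_right.trans_eq (by rw [sub_right_comm]))
  have hE : (a • e - x)⁺ ⊓ (b • e - y)⁺ ⊓ (x + y - (a + b) • e)⁺ = 0 := by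
    have hm : 0 ≤ (a • e - x)⁺ ⊓ (b • e - y)⁺ ⊓ (x + y - (a + b) • e)⁺ :=
      le_inf (le_inf (posPart_nonneg _) (posPart_nonneg _)) (posPart_nonneg _)
    have hsplit : (x + y - (a + b) • e)⁺ ≤ (x - a • e)⁺ + (y - b • e)⁺ :=
      posPart_le_add_of_le_add (le_of_eq (by module))
    have hle := le_of_le_add_of_inf_eq_zero hm (posPart_nonneg _) (posPart_nonneg _)
      (inf_le_right.trans hsplit)
      (inf_eq_zero_of_le (posPart_sub_inf_posPart_sub (a • e) x) hm (posPart_nonneg _)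
        (inf_le_left.trans inf_le_left) le_rfl)
    refine le_antisymm ?_ hm
    rw [← posPart_sub_inf_posPart_sub (b • e) y]
    exact le_inf (inf_le_left.trans inf_le_right) hle
  simp only [posPart_sub_eq_sub_inf] at hE
  have hF := map_sub_inf_map_sub_inf_map_sub_eq_zero hArch T inf_le_right inf_le_right
    inf_le_right hE
  simp only [T.map_inf, hTe, ← posPart_sub_eq_sub_inf] at hF
  refine hb (le_antisymm ?_ (le_inf (le_inf hnn (posPart_nonneg _)) (posPart_nonneg _)))
  rw [← hF, sub_sub _ (a • f), ← add_smul]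
  exact inf_le_inf_right _ (inf_le_inf_right _ (inf_le_left.trans inf_le_right))

theorem map_add_of_map_smul_weak_unit
    (hArch : ∀ x y : F, (∀ n : ℕ, n • x ≤ y) → x ≤ 0) (T : E ≃o F)
    {e : E} {f : F} (hf : 0 ≤ f) (hunit : ∀ y : F, 0 ≤ y → y ⊓ f = 0 → y = 0)
    (hTe : ∀ c : ℝ, T (c • e) = c • f) (x y : E) : T (x + y) = T x + T y := by
  refine le_antisymm (map_add_le_of_map_smul_weak_unit hArch T hf hunit hTe x y) ?_
  let S : E ≃o F := (OrderIso.neg E).trans (T.dual.trans (OrderIso.neg F).symm)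
  have hS : ∀ x, S x = -T (-x) := fun _ => rfl
  have := map_add_le_of_map_smul_weak_unit hArch S hf hunit
    (fun c => by rw [hS, ← neg_smul, hTe, neg_smul, neg_neg]) (-x) (-y)
  simp only [hS, ← neg_add, neg_neg] at this
  exact neg_le_neg_iff.1 this

theorem map_real_smul_of_monotone [PosSMulMono ℝ E]
    (hArch : ∀ x y : F, (∀ n : ℕ, n • x ≤ y) → x ≤ 0) (T : E →+ F) (hT : Monotone T)
    (c : ℝ) (x : E) : T (c • x) = c • T x := by
  have key : ∀ x : E, 0 ≤ x → T (c • x) = c • T x := by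
    intro x hx
    have hTx : 0 ≤ T x := T.map_zero ▸ hT hx
    have bound : ∀ n : ℕ, ∃ k : ℤ, (k : ℝ) ≤ n * c ∧ n * c ≤ (k + 1 : ℤ) := fun n =>
      ⟨⌊n * c⌋, Int.floor_le _, by push_cast; exact (Int.lt_floor_add_one _).le⟩
    have mulE : ∀ {a b : ℝ}, a ≤ b → a • x ≤ b • x := fun {a b} hab => by
      rw [← sub_nonneg, ← sub_smul]
      exact smul_nonneg (sub_nonneg.2 hab) hx
    have mulF : ∀ {a b : ℝ}, a ≤ b → a • T x ≤ b • T x := fun {a b} hab => by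
      rw [← sub_nonneg, ← sub_smul]
      exact smul_nonneg (sub_nonneg.2 hab) hTx
    have mapn : ∀ n : ℕ, T ((n * c : ℝ) • x) = n • T (c • x) := fun n => by
      rw [mul_smul, Nat.cast_smul_eq_nsmul, map_nsmul]
    have muln : ∀ n : ℕ, (n * c : ℝ) • T x = n • (c • T x) := fun n => by
      rw [mul_smul, Nat.cast_smul_eq_nsmul]
    have mapk : ∀ k : ℤ, T ((k : ℝ) • x) = (k : ℝ) • T x := fun k => by
      rw [Int.cast_smul_eq_zsmul, Int.cast_smul_eq_zsmul, map_zsmul]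
    have hk : ∀ k : ℤ, ((k + 1 : ℤ) : ℝ) • T x = T x + (k : ℝ) • T x := fun k => by
      push_cast
      module
    refine le_antisymm (sub_nonpos.1 (hArch _ (T x) fun n => ?_))
      (sub_nonpos.1 (hArch _ (T x) fun n => ?_))
    · obtain ⟨k, h1, h2⟩ := bound n
      rw [nsmul_sub, ← mapn, ← muln, sub_le_iff_le_add]
      calc T ((n * c : ℝ) • x) ≤ T (((k + 1 : ℤ) : ℝ) • x) := hT (mulE h2)
        _ = T x + (k : ℝ) • T x := by rw [mapk, hk]
        _ ≤ T x + (n * c : ℝ) • T x := add_le_add_right (mulF h1) _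
    · obtain ⟨k, h1, h2⟩ := bound n
      rw [nsmul_sub, ← mapn, ← muln, sub_le_iff_le_add]
      calc (n * c : ℝ) • T x ≤ ((k + 1 : ℤ) : ℝ) • T x := mulF h2
        _ = T x + T ((k : ℝ) • x) := by rw [mapk, hk]
        _ ≤ T x + T ((n * c : ℝ) • x) := add_le_add_right (hT (mulE h1)) _
  rw [← posPart_sub_negPart x, smul_sub, map_sub, map_sub, smul_sub,
    key _ (posPart_nonneg x), key _ (negPart_nonneg x)]

end Linear

end RieszAux


/-- Let `E` and `F` be Archimedean Riesz spaces, `e` a weak order unit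
of `E`, and `T : E → F` a bijective lattice homomorphism such that
`T (c • e) = c • T e` for every real `c`.  Then `T` is linear, hence a Riesz
isomorphism. -/
theorem bijective_lattice_hom_weak_unit_is_linear
    {E F : Type*}
    [AddCommGroup E] [Lattice E] [CovariantClass E E (· + ·) (· ≤ ·)]
    [Module ℝ E] [PosSMulMono ℝ E]
    [AddCommGroup F] [Lattice F] [CovariantClass F F (· + ·) (· ≤ ·)]
    [Module ℝ F] [PosSMulMono ℝ F]
    (hArchE : ∀ x y : E, (∀ n : ℕ, n • x ≤ y) → x ≤ 0)
    (hArchF : ∀ x y : F, (∀ n : ℕ, n • x ≤ y) → x ≤ 0)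
    (e : E) (he : 0 ≤ e) (heunit : ∀ y : E, 0 ≤ y → y ⊓ e = 0 → y = 0)
    (T : E → F) (hTbij : Function.Bijective T)
    (hTsup : ∀ x y : E, T (x ⊔ y) = T x ⊔ T y)
    (hTinf : ∀ x y : E, T (x ⊓ y) = T x ⊓ T y)
    (hTe : ∀ c : ℝ, T (c • e) = c • T e) :
    (∀ x y : E, T (x + y) = T x + T y) ∧ (∀ (c : ℝ) (x : E), T (c • x) = c • T x) := by
  have : IsOrderedAddMonoid E := { add_le_add_left := fun _ _ h _ => by gcongr }
  have : IsOrderedAddMonoid F := { add_le_add_left := fun _ _ h _ => by gcongr }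
  have hle : ∀ x y : E, T x ≤ T y ↔ x ≤ y := fun x y => by
    rw [← inf_eq_left, ← hTinf, hTbij.1.eq_iff, inf_eq_left]
  let T' : E ≃o F := ⟨Equiv.ofBijective T hTbij, fun {x y} => hle x y⟩
  have h0 : T 0 = 0 := by simpa using hTe 0
  have hf : 0 ≤ T e := h0 ▸ (hle 0 e).2 he
  have hunit : ∀ y : F, 0 ≤ y → y ⊓ T e = 0 → y = 0 := by
    intro y hy hye
    obtain ⟨z, rfl⟩ := hTbij.2 y
    rw [← hTinf, ← h0] at hye
    rw [← h0] at hy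
    rw [heunit z ((hle 0 z).1 hy) (hTbij.1 hye), h0]
  have hadd : ∀ x y : E, T (x + y) = T x + T y :=
    map_add_of_map_smul_weak_unit hArchF T' hf hunit hTe
  exact ⟨hadd, map_real_smul_of_monotone hArchF (AddMonoidHom.mk' T hadd) T'.monotone⟩
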